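/- Let n ≥ 1 be a natural number, ε > 0 real, β ∈ (0, 1), and qscore : Fin n → ℝ a quality score function. Let μ be a PMF on (Fin n → ℤ) such that for every i, the pushforward of μ under L ↦ L i is DLap(ε/2). Let rstar : (Fin n → ℤ) → Fin n be any function such that for every L, rstar L maximizes i ↦ qscore i + L i over Fin n. Then μ({L : ∃ r, qscore (rstar L) < qscore r − 2·(1 + (2/ε)·log(n/β))}) < β. -/

import Mathlib

open Real

/-- The mass function of the discrete Laplace distribution with scale `ε`. -/
noncomputable def dlap (ε : ℝ) (k : ℤ) : ℝ :=
  (Real.exp ε - 1) / (Real.exp ε + 1) * Real.exp (-ε * |(k : ℝ)|)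

/-- The mass that `dlap ε` puts on a ray `{m, m + 1, …}` with `m ≥ 0`. -/
theorem hasSum_dlap_add_nat {ε : ℝ} (hε : 0 < ε) (m : ℕ) :
    HasSum (fun j : ℕ => dlap ε ((m + j : ℕ) : ℤ))
      (Real.exp (-ε * m) / (1 + Real.exp (-ε))) := by
  have h1 : Real.exp (-ε) < 1 := by simpa using hε
  have hg := (hasSum_geometric_of_lt_one (Real.exp_pos (-ε)).le h1).mul_left
    ((Real.exp ε - 1) / (Real.exp ε + 1) * Real.exp (-ε * m))
  have hterm : ∀ j : ℕ, dlap ε ((m + j : ℕ) : ℤ) =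
      (Real.exp ε - 1) / (Real.exp ε + 1) * Real.exp (-ε * m) * Real.exp (-ε) ^ j := by
    intro j
    have habs : |(((m + j : ℕ) : ℤ) : ℝ)| = (m : ℝ) + j := by
      rw [Int.cast_natCast, Nat.abs_cast, Nat.cast_add]
    rw [dlap, habs, ← Real.exp_nat_mul, mul_assoc, ← Real.exp_add]
    ring_nf
  have hval : (Real.exp ε - 1) / (Real.exp ε + 1) * Real.exp (-ε * m) *
      (1 - Real.exp (-ε))⁻¹ = Real.exp (-ε * m) / (1 + Real.exp (-ε)) := by
    have h2 : 1 < Real.exp ε := by simpa using hε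
    have h3 : Real.exp ε - 1 ≠ 0 := by linarith
    have h4 : 1 - Real.exp (-ε) = (Real.exp ε - 1) / Real.exp ε := by
      rw [Real.exp_neg]
      field_simp
    have h5 : 1 + Real.exp (-ε) = (Real.exp ε + 1) / Real.exp ε := by
      rw [Real.exp_neg]
      field_simp
    rw [h4, h5]
    field_simp
  rw [← hval]
  simpa only [hterm] using hg

theorem dlap_neg (ε : ℝ) (k : ℤ) : dlap ε (-k) = dlap ε k := by
  simp [dlap]

theorem dlap_nonneg {ε : ℝ} (hε : 0 ≤ ε) (k : ℤ) : 0 ≤ dlap ε k := by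
  have : 0 ≤ Real.exp ε - 1 := by simpa using hε
  unfold dlap
  positivity

/-- Two-sided tail bound for the discrete Laplace distribution. -/
theorem toOuterMeasure_natAbs_ge_le {ε : ℝ} (hε : 0 < ε) (ν : PMF ℤ)
    (hν : ∀ k, ν k = ENNReal.ofReal (dlap ε k)) (m : ℕ) :
    ν.toOuterMeasure {k : ℤ | m ≤ k.natAbs} ≤
      ENNReal.ofReal (2 * Real.exp (-ε * m) / (1 + Real.exp (-ε))) := by
  have hray : ∑' j : ℕ, ENNReal.ofReal (dlap ε ((m + j : ℕ) : ℤ)) =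
      ENNReal.ofReal (Real.exp (-ε * m) / (1 + Real.exp (-ε))) := by
    have h := hasSum_dlap_add_nat hε m
    rw [← h.tsum_eq, ENNReal.ofReal_tsum_of_nonneg (fun _ => dlap_nonneg hε.le _) h.summable]
  have hsub : {k : ℤ | m ≤ k.natAbs} ⊆
      (⋃ j : ℕ, {((m + j : ℕ) : ℤ)}) ∪ ⋃ j : ℕ, {-((m + j : ℕ) : ℤ)} := by
    intro k hk
    simp only [Set.mem_ofPred_eq] at hk
    simp only [Set.mem_union, Set.mem_iUnion, Set.mem_singleton_iff]
    rcases le_total 0 k with h | h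
    · exact Or.inl ⟨k.natAbs - m, by omega⟩
    · exact Or.inr ⟨k.natAbs - m, by omega⟩
  calc ν.toOuterMeasure {k : ℤ | m ≤ k.natAbs}
      ≤ ν.toOuterMeasure (⋃ j : ℕ, {((m + j : ℕ) : ℤ)}) +
          ν.toOuterMeasure (⋃ j : ℕ, {-((m + j : ℕ) : ℤ)}) :=
        (MeasureTheory.measure_mono hsub).trans (MeasureTheory.measure_union_le _ _)
    _ ≤ (∑' j : ℕ, ν.toOuterMeasure {((m + j : ℕ) : ℤ)}) +
          ∑' j : ℕ, ν.toOuterMeasure {-((m + j : ℕ) : ℤ)} :=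
        add_le_add (MeasureTheory.measure_iUnion_le _) (MeasureTheory.measure_iUnion_le _)
    _ = ENNReal.ofReal (2 * Real.exp (-ε * m) / (1 + Real.exp (-ε))) := by
        simp only [PMF.toOuterMeasure_apply_singleton, hν, dlap_neg]
        rw [hray, ← ENNReal.ofReal_add (by positivity) (by positivity)]
        congr 1
        ring

/-- Accuracy of Report-noisy-max: if each coordinate of `μ` is marginally
distributed as `DLap(ε/2)` and `rstar L` maximizes the noisy score
`i ↦ qscore i + L i`, then except with probability less than `β`, the quality
score of the output is within `2 * (1 + (2/ε) * log (n/β))` of the quality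
score of every element. -/
theorem report_noisy_max_accuracy (n : ℕ) (hn : 1 ≤ n) (ε β : ℝ)
    (hε : 0 < ε) (hβ : β ∈ Set.Ioo (0:ℝ) 1) (qscore : Fin n → ℝ)
    (μ : PMF (Fin n → ℤ))
    (hμ : ∀ i : Fin n, ∀ k : ℤ,
      (μ.map (fun L => L i)) k = ENNReal.ofReal (dlap (ε / 2) k))
    (rstar : (Fin n → ℤ) → Fin n)
    (hmax : ∀ L : Fin n → ℤ, ∀ i : Fin n,
      qscore i + (L i : ℝ) ≤ qscore (rstar L) + (L (rstar L) : ℝ)) :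
    μ.toOuterMeasure
        {L : Fin n → ℤ | ∃ r : Fin n,
          qscore (rstar L) <
            qscore r - 2 * (1 + (2 / ε) * Real.log ((n : ℝ) / β))}
      < ENNReal.ofReal β := by
  obtain ⟨hβ0, hβ1⟩ := hβ
  have hn0 : (0 : ℝ) < n := by exact_mod_cast hn
  have hn1 : (1 : ℝ) ≤ n := by exact_mod_cast hn
  set T : ℝ := 1 + (2 / ε) * Real.log ((n : ℝ) / β) with hT
  have hlog : 0 ≤ Real.log ((n : ℝ) / β) :=
    Real.log_nonneg ((one_le_div hβ0).2 (hβ1.le.trans hn1))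
  have hT0 : 0 ≤ T := by positivity
  set m : ℕ := ⌊T⌋₊ + 1 with hm
  have hTm : T < m := by
    rw [hm]
    push_cast
    exact Nat.lt_floor_add_one T
  have hlarge : ∀ k : ℤ, T < |(k : ℝ)| → m ≤ k.natAbs := by
    intro k hk
    rw [← Int.cast_abs, Int.abs_eq_natAbs, Int.cast_natCast] at hk
    exact Nat.succ_le_of_lt ((Nat.floor_lt hT0).2 hk)
  have hsub : {L : Fin n → ℤ | ∃ r : Fin n, qscore (rstar L) < qscore r - 2 * T} ⊆
      ⋃ i : Fin n, (fun L : Fin n → ℤ => L i) ⁻¹' {k : ℤ | m ≤ k.natAbs} := by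
    rintro L ⟨r, hr⟩
    have h := hmax L r
    simp only [Set.mem_iUnion, Set.mem_preimage, Set.mem_ofPred_eq]
    by_cases hL : T < |(L r : ℝ)|
    · exact ⟨r, hlarge _ hL⟩
    · refine ⟨rstar L, hlarge _ (lt_of_lt_of_le ?_ (le_abs_self _))⟩
      have := (abs_le.1 (not_lt.1 hL)).1
      linarith
  set c : ℝ := 2 * Real.exp (-(ε / 2) * m) / (1 + Real.exp (-(ε / 2))) with hc
  have hcoord : ∀ i : Fin n,
      μ.toOuterMeasure ((fun L : Fin n → ℤ => L i) ⁻¹' {k : ℤ | m ≤ k.natAbs}) ≤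
        ENNReal.ofReal c := by
    intro i
    rw [← PMF.toOuterMeasure_map_apply]
    exact toOuterMeasure_natAbs_ge_le (by positivity) _ (hμ i) m
  have hexp : Real.exp (-(ε / 2) * m) < Real.exp (-(ε / 2)) * (β / n) := by
    rw [← Real.exp_log (div_pos hβ0 hn0), ← Real.exp_add, Real.exp_lt_exp,
      ← inv_div (n : ℝ) β, Real.log_inv]
    have h : ε / 2 * T = ε / 2 + Real.log ((n : ℝ) / β) := by
      rw [hT]
      field_simp
    have := mul_lt_mul_of_pos_left hTm (half_pos hε)
    linarith
  have hcβ : n * c < β := by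
    have he : Real.exp (-(ε / 2)) < 1 := by simpa using hε
    have hpos := Real.exp_pos (-(ε / 2))
    have h1 : n * Real.exp (-(ε / 2) * m) < Real.exp (-(ε / 2)) * β := by
      have h := mul_lt_mul_of_pos_left hexp hn0
      have h2 : (n : ℝ) * (Real.exp (-(ε / 2)) * (β / n)) = Real.exp (-(ε / 2)) * β := by
        field_simp
      linarith
    rw [hc, ← mul_div_assoc, div_lt_iff₀ (by positivity)]
    nlinarith
  calc μ.toOuterMeasure {L : Fin n → ℤ | ∃ r : Fin n, qscore (rstar L) < qscore r - 2 * T}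
      ≤ ∑ i : Fin n,
          μ.toOuterMeasure ((fun L : Fin n → ℤ => L i) ⁻¹' {k : ℤ | m ≤ k.natAbs}) :=
        (MeasureTheory.measure_mono hsub).trans (MeasureTheory.measure_iUnion_fintype_le _ _)
    _ ≤ ∑ _i : Fin n, ENNReal.ofReal c := Finset.sum_le_sum fun i _ => hcoord i
    _ = ENNReal.ofReal (n * c) := by
        rw [Finset.sum_const, Finset.card_univ, Fintype.card_fin, nsmul_eq_mul,
          ENNReal.ofReal_mul hn0.le, ENNReal.ofReal_natCast]
    _ < ENNReal.ofReal β := (ENNReal.ofReal_lt_ofReal_iff hβ0).2 hcβ
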